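/- For n, k ≥ 1 with n - k even, the number ξ_{1,k}(n) of n-cycles ω such that ω ∘ (1 2 ... n) has exactly k cycles satisfies the recurrence (n + 1 - k) · ξ_{1,k}(n) = Σ_{i ≥ 1} binomial(k + 2i, k - 1) · ξ_{1,k+2i}(n) + C(n, k), where C(n, k) is the unsigned Stirling number of the first kind. -/

import Mathlib

/-- Number of cycles (orbits, including fixed points) of a permutation. -/
def cycleCount {α : Type*} [Fintype α] [DecidableEq α] (σ : Equiv.Perm α) : ℕ :=
  Fintype.card α - σ.cycleType.sum + σ.cycleType.card

/-- Unsigned Stirling number of the first kind. -/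
def stirling1 (n k : ℕ) : ℕ :=
  (Finset.univ.filter (fun σ : Equiv.Perm (Fin n) => cycleCount σ = k)).card

/-- `xi n k`: the number of `n`-cycles `ω` such that `ω ∘ (1 2 ⋯ n)` has
exactly `k` cycles. -/
noncomputable def xi (n k : ℕ) : ℕ :=
  {ω : Equiv.Perm (Fin n) |
      IsConj (finRotate n) ω ∧ cycleCount (ω * finRotate n) = k}.ncard

section Meets

open Equiv Finset

open scoped Classical

variable {α : Type*}

/-- Every cycle of `σ` contains a point of `E`. -/
def Meets (σ : Perm α) (E : Finset α) : Prop :=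
  ∀ C : Set α, (∀ x ∈ C, σ x ∈ C) → (∀ x ∈ C, x ∉ E) → C = ∅

lemma Meets.mono {σ : Perm α} {E F : Finset α} (h : Meets σ E) (hEF : E ⊆ F) : Meets σ F :=
  fun C hC hd => h C hC fun x hx hxE => hd x hx (hEF hxE)

lemma delete_apply_of_fixed {ρ : Perm α} {D : Finset α} {x : α} (hρ : ∀ d ∈ D, ρ d = d) :
    ∀ d ∈ insert x D, (swap x (ρ x) * ρ) d = d := by
  intro d hd
  rcases mem_insert.1 hd with rfl | hd
  · simp
  · by_cases hdx : d = x
    · subst hdx; simp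
    · rw [Perm.mul_apply, hρ d hd, swap_apply_of_ne_of_ne hdx]
      rintro h
      exact hdx (ρ.injective (by rw [hρ d hd, h]))

variable [Fintype α]

/-- The permutations fixing every point outside `B`. -/
noncomputable def permsOn (B : Finset α) : Finset (Perm α) :=
  univ.filter fun y => ∀ x, x ∉ B → y x = x

lemma mem_permsOn {B : Finset α} {y : Perm α} : y ∈ permsOn B ↔ ∀ x, x ∉ B → y x = x := by
  simp [permsOn]

lemma permsOn_mem_iff {B : Finset α} {y : Perm α} (hy : y ∈ permsOn B) (x : α) :
    y x ∈ B ↔ x ∈ B := by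
  rw [mem_permsOn] at hy
  constructor
  · intro h
    by_contra hx
    rw [hy x hx] at h
    exact hx h
  · intro h
    by_contra hx
    have := y.injective (hy _ hx)
    rw [this] at hx
    exact hx h

lemma card_permsOn (B : Finset α) : (permsOn B).card = B.card.factorial := by
  have e := Fintype.card_congr (Perm.subtypeEquivSubtypePerm (fun x => x ∈ B))
  rw [Fintype.card_perm, Fintype.card_coe, Fintype.card_subtype] at e
  rw [e]
  rfl

lemma mul_mem_permsOn {B : Finset α} {y z : Perm α} (hy : y ∈ permsOn B) (hz : z ∈ permsOn B) :
    y * z ∈ permsOn B := by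
  rw [mem_permsOn] at *
  intro x hx
  simp [hz x hx, hy x hx]

lemma inv_mem_permsOn {B : Finset α} {y : Perm α} (hy : y ∈ permsOn B) : y⁻¹ ∈ permsOn B := by
  rw [mem_permsOn] at *
  intro x hx
  rw [Perm.inv_eq_iff_eq, hy x hx]

lemma permsOn_mono {B T : Finset α} (h : B ⊆ T) : permsOn B ⊆ permsOn T := by
  intro y hy
  rw [mem_permsOn] at *
  exact fun x hx => hy x fun h' => hx (h h')

lemma swap_mem_permsOn {B : Finset α} {x y : α} (hx : x ∈ B) (hy : y ∈ B) :
    swap x y ∈ permsOn B := by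
  rw [mem_permsOn]
  intro z hz
  exact swap_apply_of_ne_of_ne (by rintro rfl; exact hz hx) (by rintro rfl; exact hz hy)

/-- Deleting a point `x ∉ E` from a permutation: if `x` is not fixed, all cycles meet `E` exactly
when, after `x` has become a fixed point, all cycles meet `E ∪ {x}`. -/
lemma meets_iff_delete {σ : Perm α} {E : Finset α} {x : α} (hx : x ∉ E) :
    Meets σ E ↔ σ x ≠ x ∧ Meets (swap x (σ x) * σ) (insert x E) := by
  have key : ∀ w, w ≠ x → σ w ≠ x → (swap x (σ x) * σ) w = σ w := fun w h1 h2 => by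
    rw [Perm.mul_apply, swap_apply_of_ne_of_ne h2 (fun h => h1 (σ.injective h))]
  have key2 : ∀ w, σ w = x → (swap x (σ x) * σ) w = σ x := fun w h => by
    rw [Perm.mul_apply, h, swap_apply_left]
  constructor
  · intro h
    refine ⟨fun hxx => ?_, fun C hC hd => ?_⟩
    · have := h {x} (by simpa using hxx) (by simpa using hx)
      simp at this
    · have hxC : x ∉ C := fun h' => hd x h' (mem_insert_self _ _)
      by_cases hw : ∃ w ∈ C, σ w = x
      · obtain ⟨w, hwC, hw⟩ := hw
        have hσx : σ x ∈ C := by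
          have := hC w hwC
          rwa [key2 w hw] at this
        have := h (insert x C) (by
          rintro z (rfl | hz)
          · exact Or.inr hσx
          · by_cases hzx : σ z = x
            · exact Or.inl hzx
            · have := hC z hz
              rw [key z (by rintro rfl; exact hxC hz) hzx] at this
              exact Or.inr this) (by
          rintro z (rfl | hz)
          · exact hx
          · exact fun h' => hd z hz (mem_insert_of_mem h'))
        exact absurd this (Set.insert_nonempty x C).ne_empty
      · push Not at hw
        refine h C (fun z hz => ?_) (fun z hz h' => hd z hz (mem_insert_of_mem h'))
        have := hC z hz
        rwa [key z (by rintro rfl; exact hxC hz) (hw z hz)] at this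
  · rintro ⟨h1, h⟩ C hC hd
    have h0 := h (C \ {x}) (by
      rintro z ⟨hz, hzx⟩
      have hzx : z ≠ x := hzx
      by_cases hz' : σ z = x
      · rw [key2 z hz']
        exact ⟨hC _ (hz' ▸ hC z hz), h1⟩
      · rw [key z hzx hz']
        exact ⟨hC z hz, hz'⟩) (by
      rintro z ⟨hz, hzx⟩ h'
      rcases mem_insert.1 h' with h' | h'
      · exact hzx h'
      · exact hd z hz h')
    have hsub : C ⊆ {x} := Set.sdiff_eq_empty.1 h0
    rcases Set.subset_singleton_iff_eq.1 hsub with h2 | h2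
    · exact h2
    · exact absurd (by simpa [h2] using hC x (by simp [h2])) h1

lemma meets_univ (σ : Perm α) : Meets σ univ := fun _ _ hd =>
  Set.eq_empty_of_forall_notMem fun x hx => hd x hx (mem_univ x)

/-- The number of permutations of `B` all of whose cycles meet `E ⊆ B`. -/
lemma card_permsOn_meets {B E : Finset α} (hE : E ⊆ B) (hB : B.Nonempty) :
    ((permsOn B).filter fun z => Meets z (E ∪ Bᶜ)).card = E.card * (B.card - 1).factorial := by
  induction hm : (B \ E).card generalizing B E with
  | zero =>
    have : E = B := hE.antisymm (sdiff_eq_empty_iff_subset.1 (card_eq_zero.1 hm))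
    subst this
    rw [filter_true_of_mem (fun z _ => by rw [union_compl]; exact meets_univ z), card_permsOn,
      Nat.mul_factorial_pred (card_pos.2 hB).ne']
  | succ m ih =>
    obtain ⟨x, hx⟩ : (B \ E).Nonempty := card_pos.1 (by lia)
    rw [mem_sdiff] at hx
    obtain ⟨hxB, hxE⟩ := hx
    have hxn : x ∉ E ∪ Bᶜ := by simp [hxB, hxE]
    have hins : insert x (E ∪ Bᶜ) = E ∪ (B.erase x)ᶜ := by
      ext z; simp only [mem_insert, mem_union, mem_compl, mem_erase]; tauto
    have hE' : E ⊆ B.erase x := fun z hz => mem_erase.2 ⟨by rintro rfl; exact hxE hz, hE hz⟩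
    have hcard : (B.erase x).card = B.card - 1 := card_erase_of_mem hxB
    have hfib : ((permsOn B).filter fun z => Meets z (E ∪ Bᶜ)).card =
        (B.erase x ×ˢ (permsOn (B.erase x)).filter fun z => Meets z (E ∪ (B.erase x)ᶜ)).card := by
      refine card_nbij' (fun z => (z x, swap x (z x) * z)) (fun p => swap x p.1 * p.2)
        ?_ ?_ ?_ ?_
      · intro z hz
        simp only [coe_filter, Set.mem_ofPred_eq, meets_iff_delete hxn, hins] at hz
        obtain ⟨hz, hzx, hm⟩ := hz
        have hzB : z x ∈ B := (permsOn_mem_iff hz x).2 hxB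
        simp only [coe_product, coe_erase, coe_filter, Set.mem_prod, Set.mem_sdiff, mem_coe,
          Set.mem_singleton_iff, Set.mem_ofPred_eq]
        refine ⟨⟨hzB, hzx⟩, ?_, hm⟩
        have := mul_mem_permsOn (swap_mem_permsOn hxB hzB) hz
        rw [mem_permsOn] at this ⊢
        intro w hw
        by_cases hwx : w = x
        · subst hwx; simp
        · exact this w fun h => hw (mem_erase.2 ⟨hwx, h⟩)
      · rintro ⟨u, z⟩ hz
        simp only [coe_product, coe_erase, coe_filter, Set.mem_prod, Set.mem_sdiff, mem_coe,
          Set.mem_singleton_iff, Set.mem_ofPred_eq] at hz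
        obtain ⟨⟨huB, hux⟩, hz, hm⟩ := hz
        have hzx : z x = x := mem_permsOn.1 hz x (by simp)
        simp only [coe_filter, Set.mem_ofPred_eq, meets_iff_delete hxn, hins]
        refine ⟨mul_mem_permsOn (swap_mem_permsOn hxB huB) (permsOn_mono (erase_subset _ _) hz),
          by simpa [hzx] using hux, ?_⟩
        simpa [hzx] using hm
      · intro z _
        simp
      · rintro ⟨u, z⟩ hz
        simp only [coe_product, coe_erase, coe_filter, Set.mem_prod, Set.mem_sdiff, mem_coe,
          Set.mem_singleton_iff, Set.mem_ofPred_eq] at hz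
        have hzx : z x = x := mem_permsOn.1 hz.2.1 x (by simp)
        simp [hzx]
    rw [hfib, card_product]
    by_cases hne : (B.erase x).Nonempty
    · rw [ih hE' hne (by
        rw [show B.erase x \ E = (B \ E).erase x by ext z; simp; tauto,
          card_erase_of_mem (by simp [hxB, hxE]), hm]; rfl), hcard]
      have : B.card - 1 ≠ 0 := hcard ▸ (card_pos.2 hne).ne'
      rw [← Nat.mul_factorial_pred this]
      ring
    · rw [not_nonempty_iff_eq_empty] at hne
      have : E = ∅ := subset_empty.1 (hne ▸ hE')
      simp [hne, this]

/-- The number of `y` supported on `B` for which no cycle of `y * κ` is contained in `B`. -/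
lemma card_permsOn_mul_meets_compl (κ : Perm α) {B : Finset α} (hB : B.Nonempty) :
    ((permsOn B).filter fun y => Meets (y * κ) Bᶜ).card =
      (B.filter fun b => κ b ∉ B).card * (B.card - 1).factorial := by
  let e : {x : B // κ x ∈ B} ≃ {x : B // κ⁻¹ x ∈ B} :=
    { toFun := fun x => ⟨⟨κ x, x.2⟩, by simp⟩
      invFun := fun x => ⟨⟨κ⁻¹ x, x.2⟩, by simp⟩
      left_inv := fun x => by simp
      right_inv := fun x => by simp }
  let θ : Perm α := Perm.ofSubtype e.extendSubtype
  have hθB : θ ∈ permsOn B := mem_permsOn.2 fun x hx => Perm.ofSubtype_apply_of_not_mem _ hx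
  have hθ : ∀ x ∈ B, κ x ∈ B → θ x = κ x := fun x hx hκ => by
    have h1 := e.extendSubtype_apply_of_mem ⟨x, hx⟩ hκ
    have h2 : θ x = e.extendSubtype ⟨x, hx⟩ := Perm.ofSubtype_apply_of_mem _ hx
    rw [h2, h1]
    rfl
  rw [← card_permsOn_meets (filter_subset _ B) hB]
  have hagree : ∀ y x, x ∉ (B.filter fun b => κ b ∉ B) ∪ Bᶜ → (y * κ) x = (y * θ) x := by
    intro y x hx
    simp only [mem_union, mem_filter, mem_compl, not_or, not_and, not_not] at hx
    rw [Perm.mul_apply, Perm.mul_apply, hθ x hx.2 (hx.1 hx.2)]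
  have hiff : ∀ y ∈ permsOn B,
      (Meets (y * κ) Bᶜ ↔ Meets (y * θ) ((B.filter fun b => κ b ∉ B) ∪ Bᶜ)) := by
    intro y hy
    constructor
    · intro h C hC hd
      refine h C (fun x hx => ?_) (fun x hx h' => hd x hx (mem_union_right _ h'))
      rw [hagree y x (hd x hx)]
      exact hC x hx
    · intro h C hC hd
      have hd' : ∀ x ∈ C, x ∉ (B.filter fun b => κ b ∉ B) ∪ Bᶜ := by
        intro x hx
        have h1 := hd x hx
        have h2 := hd _ (hC x hx)
        simp only [mem_compl, not_not, Perm.mul_apply, permsOn_mem_iff hy] at h1 h2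
        simp [h1, h2]
      refine h C (fun x hx => ?_) hd'
      rw [← hagree y x (hd' x hx)]
      exact hC x hx
  refine card_nbij' (fun y => y * θ) (fun z => z * θ⁻¹) ?_ ?_ ?_ ?_
  · intro y hy
    rw [mem_coe, mem_filter] at hy ⊢
    exact ⟨mul_mem_permsOn hy.1 hθB, (hiff y hy.1).1 hy.2⟩
  · intro z hz
    rw [mem_coe, mem_filter] at hz ⊢
    have hz' := mul_mem_permsOn hz.1 (inv_mem_permsOn hθB)
    exact ⟨hz', (hiff _ hz').2 (by simpa using hz.2)⟩
  · intro y _; simp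
  · intro z _; simp

lemma meets_mul_mul_delete {h ρ k : Perm α} {E : Finset α} {x : α} (hh : h x = x) (hk : k x = x)
    (hx : x ∉ E) :
    Meets (h * ρ * k) E ↔ ρ x ≠ x ∧ Meets (h * (swap x (ρ x) * ρ) * k) (insert x E) := by
  have e : swap x ((h * ρ * k) x) * (h * ρ * k) = h * (swap x (ρ x) * ρ) * k := by
    have hh' : h⁻¹ x = x := by rw [Perm.inv_eq_iff_eq, hh]
    have := swap_mul_eq_mul_swap h x (h (ρ x))
    rw [hh', show h⁻¹ (h (ρ x)) = ρ x by simp] at this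
    rw [Perm.mul_apply, Perm.mul_apply, hk, ← mul_assoc, ← mul_assoc, this]
    simp only [mul_assoc]
  rw [meets_iff_delete hx, e]
  refine and_congr_left fun _ => not_congr ?_
  rw [Perm.mul_apply, Perm.mul_apply, hk]
  conv_lhs => rw [← hh]
  rw [h.apply_eq_iff_eq, hh]

lemma card_compl_insert {F : Finset α} {x : α} {m : ℕ} (hx : x ∉ F) (hm : Fᶜ.card = m + 1) :
    (insert x F)ᶜ.card = m := by
  rw [card_compl] at hm ⊢
  rw [card_insert_of_notMem hx]
  lia

lemma card_permsOn_mul_meets_fixed {B D : Finset α} (hBD : Disjoint B D) {a : α} (ha : a ∈ B)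
    {ρ : Perm α} (hρ : ∀ d ∈ D, ρ d = d) :
    ((permsOn B).filter fun y => Meets (y * ρ) (insert a D)).card =
      if Meets ρ (B ∪ D) then (B.card - 1).factorial else 0 := by
  induction hm : (B ∪ D)ᶜ.card generalizing D ρ with
  | zero =>
    have hu : B ∪ D = univ := by
      rw [← compl_eq_empty_iff, ← card_eq_zero, hm]
    have hD : D = Bᶜ := by
      rw [eq_compl_iff_isCompl]
      exact ⟨hBD.symm, codisjoint_iff.2 (by rw [sup_eq_union, union_comm, hu]; rfl)⟩
    subst hD
    have hρB : ρ ∈ permsOn B := mem_permsOn.2 fun x hx => hρ x (mem_compl.2 hx)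
    have h1 := card_permsOn_meets (singleton_subset_iff.2 ha) ⟨a, ha⟩
    rw [card_singleton, one_mul] at h1
    rw [hu, if_pos (meets_univ ρ), ← h1]
    refine card_nbij' (fun y => y * ρ) (fun z => z * ρ⁻¹) ?_ ?_ ?_ ?_
    · intro y hy
      rw [mem_coe, mem_filter] at hy ⊢
      exact ⟨mul_mem_permsOn hy.1 hρB, hy.2⟩
    · intro z hz
      rw [mem_coe, mem_filter] at hz ⊢
      exact ⟨mul_mem_permsOn hz.1 (inv_mem_permsOn hρB), by simpa using hz.2⟩
    · intro y _; simp
    · intro z _; simp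
  | succ m ih =>
    obtain ⟨x, hx⟩ : (B ∪ D)ᶜ.Nonempty := card_pos.1 (by lia)
    have hx' := mem_compl.1 hx
    have hxB : x ∉ B := fun h => hx' (mem_union_left _ h)
    have hxD : x ∉ D := fun h => hx' (mem_union_right _ h)
    have hxa : x ∉ insert a D := by
      rw [mem_insert, not_or]; exact ⟨by rintro rfl; exact hxB ha, hxD⟩
    have e1 := fun y (hy : y ∈ permsOn B) =>
      meets_mul_mul_delete (h := y) (ρ := ρ) (k := 1) (mem_permsOn.1 hy x hxB) rfl hxa
    have e2 := meets_mul_mul_delete (h := 1) (ρ := ρ) (k := 1) rfl rfl hx'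
    simp only [mul_one, one_mul] at e1 e2
    rw [filter_congr e1]
    by_cases hfix : ρ x = x
    · simp [e2, hfix]
    · have := ih (disjoint_insert_right.2 ⟨hxB, hBD⟩) (delete_apply_of_fixed hρ)
        (by rw [union_insert]; exact card_compl_insert hx' hm)
      simp only [ne_eq, hfix, not_false_eq_true, true_and, e2]
      rw [Finset.insert_comm, this, union_insert]

/-- Multiplying by a permutation of `B` can merge all cycles of `ρ` meeting `B` into one. -/
lemma card_permsOn_mul_meets_singleton {B : Finset α} {a : α} (ha : a ∈ B) (ρ : Perm α) :
    ((permsOn B).filter fun y => Meets (y * ρ) {a}).card =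
      if Meets ρ B then (B.card - 1).factorial else 0 := by
  simpa using card_permsOn_mul_meets_fixed (disjoint_empty_right B) ha (ρ := ρ) (by simp)

lemma meets_compl_singleton {σ : Perm α} {b : α} : Meets σ {b}ᶜ ↔ σ b ≠ b := by
  constructor
  · intro h hb
    have := h {b} (by simpa using hb) (by simp)
    simp at this
  · intro hb C hC hd
    have hsub : C ⊆ {b} := fun x hx => by simpa using hd x hx
    rcases Set.subset_singleton_iff_eq.1 hsub with h2 | h2
    · exact h2
    · exact absurd (by simpa [h2] using hC b (by simp [h2])) hb

lemma exists_permsOn_two {T : Finset α} {t u t' u' : α} (ht : t ∈ T) (hu : u ∈ T) (ht' : t' ∈ T)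
    (hu' : u' ∈ T) (h : t ≠ u) (h' : t' ≠ u') : ∃ g ∈ permsOn T, g t = t' ∧ g u = u' := by
  have h1 := swap_mem_permsOn ht ht'
  have hw : swap t t' u ∈ T := (permsOn_mem_iff h1 u).2 hu
  refine ⟨swap (swap t t' u) u' * swap t t', mul_mem_permsOn (swap_mem_permsOn hw hu') h1, ?_, ?_⟩
  · rw [Perm.mul_apply, swap_apply_left, swap_apply_of_ne_of_ne _ h']
    intro e
    have : swap t t' t = swap t t' u := by rw [swap_apply_left, ← e]
    exact h ((swap t t').injective this)
  · simp

/-- Number of conjugates of `ρ` over `permsOn T` sending `t` to `u` does not depend on `t ≠ u`. -/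
lemma card_conj_apply_eq {T : Finset α} (ρ : Perm α) {t u t' u' : α} (ht : t ∈ T) (hu : u ∈ T)
    (ht' : t' ∈ T) (hu' : u' ∈ T) (h : t ≠ u) (h' : t' ≠ u') :
    ((permsOn T).filter fun g => (g * ρ * g⁻¹) t = u).card =
      ((permsOn T).filter fun g => (g * ρ * g⁻¹) t' = u').card := by
  obtain ⟨k, hk, hkt, hku⟩ := exists_permsOn_two ht hu ht' hu' h h'
  refine card_nbij' (fun g => k * g) (fun g => k⁻¹ * g) ?_ ?_ ?_ ?_
  · intro g hg
    rw [mem_coe, mem_filter] at hg ⊢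
    refine ⟨mul_mem_permsOn hk hg.1, ?_⟩
    rw [← hkt, ← hku, ← hg.2]
    simp
  · intro g hg
    rw [mem_coe, mem_filter] at hg ⊢
    refine ⟨mul_mem_permsOn (inv_mem_permsOn hk) hg.1, ?_⟩
    have := hg.2
    rw [← hkt, ← hku] at this
    rw [← k.apply_eq_iff_eq, ← this]
    simp
  · intro g _; simp
  · intro g _; simp

lemma sum_conj_card_meets_fixed {S B D : Finset α} (hSB : Disjoint S B) (hD : Disjoint (S ∪ B) D)
    {b : α} (hb : b ∈ B) {ρ : Perm α} (hρ : ∀ d ∈ D, ρ d = d) :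
    ((S ∪ B).erase b).card * ∑ g ∈ permsOn (S ∪ B),
        ((permsOn B).filter fun y => Meets (y * (g * ρ * g⁻¹)) (S ∪ D)).card =
      S.card * B.card.factorial *
        ((permsOn (S ∪ B)).filter fun g =>
          Meets (g * ρ * g⁻¹) ((S ∪ B).erase b ∪ D)).card := by
  induction hm : (S ∪ B ∪ D)ᶜ.card generalizing D ρ with
  | zero =>
    set T := S ∪ B with hT
    have hbT : b ∈ T := mem_union_right _ hb
    have hBT : B ⊆ T := subset_union_right
    have hST : S ⊆ T := subset_union_left
    have hu : ∀ x, x ∈ T ∨ x ∈ D := fun x => by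
      rw [← mem_union, ← notMem_compl, card_eq_zero.1 hm]; exact notMem_empty x
    have hρT : ρ ∈ permsOn T := mem_permsOn.2 fun x hx => hρ x ((hu x).resolve_left hx)
    have hnD : ∀ x ∈ T, x ∉ D := fun x hx hxD => disjoint_left.1 hD hx hxD
    have hSD : S ∪ D = Bᶜ := by
      ext x
      rw [mem_union, mem_compl]
      constructor
      · rintro (h | h) hxB
        · exact disjoint_left.1 hSB h hxB
        · exact hnD x (hBT hxB) h
      · intro hxB
        rcases hu x with h | h
        · exact Or.inl ((mem_union.1 h).resolve_right hxB)
        · exact Or.inr h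
    have hbD : T.erase b ∪ D = {b}ᶜ := by
      ext x
      rw [mem_union, mem_erase, mem_compl, mem_singleton]
      constructor
      · rintro (h | h)
        · exact h.1
        · rintro rfl; exact hnD _ hbT h
      · intro h
        rcases hu x with h' | h'
        · exact Or.inl ⟨h, h'⟩
        · exact Or.inr h'
    have hconj : ∀ g ∈ permsOn T, g * ρ * g⁻¹ ∈ permsOn T := fun g hg =>
      mul_mem_permsOn (mul_mem_permsOn hg hρT) (inv_mem_permsOn hg)
    rw [hSD, hbD]
    simp only [card_permsOn_mul_meets_compl _ ⟨b, hb⟩, meets_compl_singleton]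
    rw [← sum_mul]
    have hne : ∀ t, t ∈ T → ∀ P : Finset α, P ⊆ T → t ∉ P → ∀ N : ℕ,
        (∀ u ∈ P, ((permsOn T).filter fun g => (g * ρ * g⁻¹) t = u).card = N) →
        ((permsOn T).filter fun g => (g * ρ * g⁻¹) t ∈ P).card = P.card * N := by
      intro t ht P hP htP N hN
      rw [card_eq_sum_card_fiberwise (s := (permsOn T).filter fun g => (g * ρ * g⁻¹) t ∈ P)
        (f := fun g => (g * ρ * g⁻¹) t) (t := P) (fun g hg => (mem_filter.1 hg).2), ← smul_eq_mul,
      ← sum_const]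
      refine sum_congr rfl fun u hu => ?_
      rw [← hN u hu, filter_filter]
      congr 1
      refine filter_congr fun g _ => ?_
      constructor
      · exact fun h => h.2
      · exact fun h => ⟨h ▸ hu, h⟩
    rcases S.eq_empty_or_nonempty with rfl | ⟨s, hs⟩
    · have hTB : T = B := empty_union B
      rw [sum_eq_zero]
      · simp
      · intro g hg
        rw [card_eq_zero, filter_eq_empty_iff]
        intro x hx h
        exact h (hTB ▸ (permsOn_mem_iff (hconj g hg) x).2 (hTB.symm ▸ hx))
    have hsb : ∀ s ∈ S, ∀ b ∈ B, b ≠ s := fun s hs b hb e => disjoint_left.1 hSB hs (e ▸ hb)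
    set N := ((permsOn T).filter fun g => (g * ρ * g⁻¹) b = s).card
    have h1 : ((permsOn T).filter fun g => (g * ρ * g⁻¹) b ≠ b).card = (T.erase b).card * N := by
      rw [← hne b hbT (T.erase b) (erase_subset _ _) (by simp) N]
      · congr 1
        refine filter_congr fun g hg => ?_
        rw [mem_erase, permsOn_mem_iff (hconj g hg)]
        tauto
      · intro u hu
        exact card_conj_apply_eq ρ hbT (mem_of_mem_erase hu) hbT (hST hs)
          (ne_of_mem_erase hu).symm (hsb s hs b hb)
    have h2 : ∑ g ∈ permsOn T, (B.filter fun b' => (g * ρ * g⁻¹) b' ∉ B).card =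
        B.card * (S.card * N) := by
      simp only [card_filter]
      rw [sum_comm, ← smul_eq_mul, ← sum_const]
      refine sum_congr rfl fun b' hb' => ?_
      rw [← card_filter, ← hne b' (hBT hb') S hST (disjoint_right.1 hSB hb') N]
      · congr 1
        refine filter_congr fun g hg => ?_
        have h3 := (permsOn_mem_iff (hconj g hg) b').2 (hBT hb')
        exact ⟨fun h => (mem_union.1 h3).resolve_right h, fun h => disjoint_left.1 hSB h⟩
      · intro u hu
        exact card_conj_apply_eq ρ (hBT hb') (hST hu) hbT (hST hs) (hsb u hu b' hb')
          (hsb s hs b hb)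
    rw [h1, h2, ← Nat.mul_factorial_pred (card_pos.2 ⟨b, hb⟩).ne']
    ring
  | succ m ih =>
    obtain ⟨x, hx⟩ : (S ∪ B ∪ D)ᶜ.Nonempty := card_pos.1 (by lia)
    have hx' := mem_compl.1 hx
    have hxT : x ∉ S ∪ B := fun h => hx' (mem_union_left _ h)
    have hxD : x ∉ D := fun h => hx' (mem_union_right _ h)
    have hxS : x ∉ S := fun h => hxT (mem_union_left _ h)
    have hxB : x ∉ B := fun h => hxT (mem_union_right _ h)
    have hg1 : ∀ g ∈ permsOn (S ∪ B), g⁻¹ x = x := fun g hg =>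
      mem_permsOn.1 (inv_mem_permsOn hg) x hxT
    have e1 : ∀ g ∈ permsOn (S ∪ B), ∀ y ∈ permsOn B,
        (Meets (y * (g * ρ * g⁻¹)) (S ∪ D) ↔ ρ x ≠ x ∧
          Meets (y * (g * (swap x (ρ x) * ρ) * g⁻¹)) (S ∪ insert x D)) := fun g hg y hy => by
      have := meets_mul_mul_delete (h := y * g) (ρ := ρ) (k := g⁻¹) (E := S ∪ D) (x := x)
        (by rw [Perm.mul_apply, mem_permsOn.1 hg x hxT, mem_permsOn.1 hy x hxB])
        (hg1 g hg) (by simp [hxS, hxD])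
      simpa only [mul_assoc, union_insert] using this
    have e2 : ∀ g ∈ permsOn (S ∪ B),
        (Meets (g * ρ * g⁻¹) ((S ∪ B).erase b ∪ D) ↔ ρ x ≠ x ∧
          Meets (g * (swap x (ρ x) * ρ) * g⁻¹) ((S ∪ B).erase b ∪ insert x D)) := fun g hg => by
      have := meets_mul_mul_delete (h := g) (ρ := ρ) (k := g⁻¹) (E := (S ∪ B).erase b ∪ D) (x := x)
        (mem_permsOn.1 hg x hxT) (hg1 g hg)
        (by rw [mem_union, not_or]; exact ⟨fun h => hxT (mem_of_mem_erase h), hxD⟩)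
      simpa only [union_insert] using this
    rw [filter_congr e2, sum_congr rfl fun g hg => by rw [filter_congr (e1 g hg)]]
    by_cases hfix : ρ x = x
    · simp [hfix]
    · have := ih (disjoint_insert_right.2 ⟨hxT, hD⟩) (delete_apply_of_fixed hρ)
        (by rw [union_insert]; exact card_compl_insert hx' hm)
      simpa only [ne_eq, hfix, not_false_eq_true, true_and] using this

/-- Averaging over conjugates by permutations of `S ∪ B`. -/
lemma sum_conj_card_meets {S B : Finset α} (hSB : Disjoint S B) {b : α} (hb : b ∈ B)
    (ρ : Perm α) :
    ((S ∪ B).erase b).card * ∑ g ∈ permsOn (S ∪ B),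
        ((permsOn B).filter fun y => Meets (y * (g * ρ * g⁻¹)) S).card =
      S.card * B.card.factorial *
        ((permsOn (S ∪ B)).filter fun g => Meets (g * ρ * g⁻¹) ((S ∪ B).erase b)).card := by
  simpa using sum_conj_card_meets_fixed hSB (disjoint_empty_right _) hb (ρ := ρ) (by simp)

lemma Meets.singleton {c : Perm α} {a : α} (h : Meets c {a}) (b : α) : Meets c {b} := by
  intro C hC hd
  by_contra hne
  have haC : a ∈ C := by
    by_contra haC
    exact hne (h C hC fun x hx hxa => haC (by rwa [mem_singleton.1 hxa] at hx))
  have hinv : ∀ x ∈ C, c.symm x ∈ C := Perm.perm_symm_mapsTo_of_mapsTo c hC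
  have := h Cᶜ (fun x hx hcx => hx (by simpa using hinv _ hcx))
    (fun x hx hxa => hx (by rwa [mem_singleton.1 hxa]))
  exact hd b (by rw [← compl_compl C, this]; simp) (mem_singleton_self b)

lemma Meets.of_nonempty {c : Perm α} {a : α} (h : Meets c {a}) {E : Finset α} (hE : E.Nonempty) :
    Meets c E := by
  obtain ⟨b, hb⟩ := hE
  exact (h.singleton b).mono (singleton_subset_iff.2 hb)

lemma Meets.inv {c : Perm α} {E : Finset α} (h : Meets c E) : Meets c⁻¹ E := by
  intro C hC hd
  refine h C (fun x hx => ?_) hd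
  have : ∀ x ∈ C, (c⁻¹).symm x ∈ C := Perm.perm_symm_mapsTo_of_mapsTo c⁻¹ hC
  exact this x hx

/-- The cyclic permutations of `α`, described through a point `a`. -/
noncomputable def fullCycles (a : α) : Finset (Perm α) := univ.filter fun c => Meets c {a}

lemma mem_fullCycles {a : α} {c : Perm α} : c ∈ fullCycles a ↔ Meets c {a} := by
  simp [fullCycles]

lemma card_fullCycles (a : α) : (fullCycles a).card = (Fintype.card α - 1).factorial := by
  have := card_permsOn_meets (subset_univ {a}) ⟨a, mem_univ a⟩
  rw [card_singleton, one_mul, card_univ] at this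
  rw [← this]
  congr 1
  ext c
  simp [fullCycles, permsOn]

lemma conj_mem_fullCycles {a : α} {c : Perm α} (g : Perm α) (hc : c ∈ fullCycles a) :
    g * c * g⁻¹ ∈ fullCycles a := by
  rw [mem_fullCycles] at *
  refine Meets.singleton (a := g a) (fun C hC hd => ?_) a
  have := hc (g ⁻¹' C) (fun x hx => by simpa using hC _ hx)
    (fun x hx hE => hd _ hx (by rw [mem_singleton.1 hE]; simp))
  rwa [Set.preimage_eq_empty_iff, Equiv.range_eq_univ, Set.disjoint_univ] at this

lemma sum_fullCycles_conj {M : Type*} [AddCommMonoid M] (a : α) (g : Perm α) (φ : Perm α → M) :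
    ∑ c ∈ fullCycles a, φ (g * c * g⁻¹) = ∑ c ∈ fullCycles a, φ c := by
  refine sum_nbij' (fun c => g * c * g⁻¹) (fun c => g⁻¹ * c * g) ?_ ?_ ?_ ?_ ?_
  · exact fun c hc => conj_mem_fullCycles g hc
  · exact fun c hc => by simpa using conj_mem_fullCycles g⁻¹ hc
  · intro c _; simp [mul_assoc]
  · intro c _; simp [mul_assoc]
  · intro c _; rfl

variable {β : Type*} [DecidableEq β]

/-- The permutations preserving the coloring `f` and moving only points with color in `V`. -/
noncomputable def colorPerms (f : α → β) (V : Finset β) : Finset (Perm α) :=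
  univ.filter fun y => (∀ x, f (y x) = f x) ∧ ∀ x, f x ∉ V → y x = x

lemma mem_colorPerms {f : α → β} {V : Finset β} {y : Perm α} :
    y ∈ colorPerms f V ↔ (∀ x, f (y x) = f x) ∧ ∀ x, f x ∉ V → y x = x := by
  simp [colorPerms]

lemma sum_colorPerms_insert {M : Type*} [AddCommMonoid M] (f : α → β) {V : Finset β} {v : β}
    (hv : v ∉ V) (φ : Perm α → M) :
    ∑ z ∈ colorPerms f (insert v V), φ z =
      ∑ y' ∈ colorPerms f V, ∑ y ∈ permsOn (univ.filter fun x => f x = v), φ (y * y') := by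
  symm
  rw [← sum_product' (f := fun y' y => φ (y * y'))]
  have hB : ∀ y ∈ permsOn (univ.filter fun x => f x = v), ∀ x, f x ≠ v → y x = x :=
    fun y hy x hx => mem_permsOn.1 hy x (by simpa using hx)
  have hBf : ∀ y ∈ permsOn (univ.filter fun x => f x = v), ∀ x, f (y x) = f x := by
    intro y hy x
    by_cases hx : f x = v
    · have := (permsOn_mem_iff hy x).2 (by simpa using hx)
      rw [hx]
      simpa using this
    · rw [hB y hy x hx]
  refine sum_nbij (fun p => p.2 * p.1) ?_ ?_ ?_ ?_
  · rintro ⟨y', y⟩ h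
    obtain ⟨h', h⟩ := mem_product.1 h
    rw [mem_colorPerms] at h' ⊢
    refine ⟨fun x => ?_, fun x hx => ?_⟩
    · rw [Perm.mul_apply, hBf y h, h'.1]
    · rw [mem_insert, not_or] at hx
      rw [Perm.mul_apply, h'.2 x hx.2, hB y h x hx.1]
  · rintro ⟨y', y⟩ h ⟨z', z⟩ hz e
    obtain ⟨h', h⟩ := mem_product.1 (mem_coe.1 h)
    obtain ⟨hz', hz⟩ := mem_product.1 (mem_coe.1 hz)
    have e : y * y' = z * z' := e
    have : y = z := by
      ext x
      by_cases hx : f x = v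
      · have h1 := congrArg (fun g : Perm α => g x) e
        simp only [Perm.mul_apply] at h1
        rwa [(mem_colorPerms.1 h').2 x (hx ▸ hv), (mem_colorPerms.1 hz').2 x (hx ▸ hv)] at h1
      · rw [hB y h x hx, hB z hz x hx]
    subst this
    rw [mul_right_inj] at e
    rw [e]
  · intro z hz
    rw [mem_coe, mem_colorPerms] at hz
    let y : Perm α := Perm.ofSubtype (z.subtypePerm (p := fun x => f x = v) fun x => by rw [hz.1])
    have hy1 : ∀ x, f x = v → y x = z x := fun x hx =>
      Perm.ofSubtype_apply_of_mem (p := fun x => f x = v) _ hx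
    have hy2 : ∀ x, f x ≠ v → y x = x := fun x hx =>
      Perm.ofSubtype_apply_of_not_mem (p := fun x => f x = v) _ hx
    have hy : y ∈ permsOn (univ.filter fun x => f x = v) :=
      mem_permsOn.2 fun x hx => hy2 x (by simpa using hx)
    refine ⟨(y⁻¹ * z, y), ?_, by simp⟩
    rw [mem_coe, mem_product]
    refine ⟨mem_colorPerms.2 ⟨fun x => ?_, fun x hx => ?_⟩, hy⟩
    · rw [Perm.mul_apply, hBf _ (inv_mem_permsOn hy), hz.1]
    · rw [Perm.mul_apply, Perm.inv_eq_iff_eq]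
      by_cases hxv : f x = v
      · exact (hy1 x hxv).symm
      · rw [hy2 x hxv]
        exact hz.2 x (by simp [hxv, hx])
  · intro p _; rfl

lemma card_colorPerms_insert (f : α → β) {V : Finset β} {v : β} (hv : v ∉ V) :
    (colorPerms f (insert v V)).card =
      (univ.filter fun x => f x = v).card.factorial * (colorPerms f V).card := by
  have := sum_colorPerms_insert f hv (fun _ => 1)
  simp only [sum_const, smul_eq_mul, mul_one, card_permsOn] at this
  rw [this, mul_comm]

lemma colorPerms_empty (f : α → β) : colorPerms f ∅ = {1} := by
  ext y
  rw [mem_colorPerms, mem_singleton]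
  constructor
  · rintro ⟨-, h⟩
    ext x
    exact h x (notMem_empty _)
  · rintro rfl
    simp

lemma card_fullCycles_colorPerms_meets (f : α → β) (a : α) (rep : β → α)
    (hrep : ∀ x, f (rep (f x)) = f x) (V : Finset β) (hV : V ⊆ (univ.image f).erase (f a)) :
    (univ.filter fun x => f x = f a ∨ rep (f x) ≠ x).card *
      ∑ c ∈ fullCycles a, ((colorPerms f V).filter fun y =>
        Meets (y * c) (univ.filter fun x => f x ∉ V ∧ (f x = f a ∨ rep (f x) ≠ x))).card =
    (univ.filter fun x => f x ∉ V ∧ (f x = f a ∨ rep (f x) ≠ x)).card *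
      (colorPerms f V).card * (Fintype.card α - 1).factorial := by
  induction V using Finset.induction_on with
  | empty =>
    have h1 : ∀ c ∈ fullCycles a,
        Meets c (univ.filter fun x => f x = f a ∨ rep (f x) ≠ x) := fun c hc =>
      (mem_fullCycles.1 hc).of_nonempty ⟨a, by simp⟩
    simp only [colorPerms_empty, notMem_empty, not_false_eq_true, true_and, card_singleton,
      mul_one]
    rw [sum_congr rfl (g := fun _ => 1) fun c hc => by
      rw [card_eq_one]
      exact ⟨1, filter_true_of_mem fun y hy => by
        rw [mem_singleton.1 hy, one_mul]; exact h1 c hc⟩]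
    simp [card_fullCycles]
  | insert v V hv ih =>
    have ih := ih ((subset_insert v V).trans hV)
    have hvQ := mem_erase.1 (hV (mem_insert_self v V))
    obtain ⟨x₀, -, hx₀⟩ := mem_image.1 hvQ.2
    set m := (univ.filter fun x => f x = f a ∨ rep (f x) ≠ x).card
    set B : Finset α := univ.filter fun x => f x = v with hB
    set S : Finset α :=
      univ.filter fun x => f x ∉ insert v V ∧ (f x = f a ∨ rep (f x) ≠ x) with hS
    set S' : Finset α := univ.filter fun x => f x ∉ V ∧ (f x = f a ∨ rep (f x) ≠ x) with hS'
    have hb : rep v ∈ B := by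
      rw [hB, mem_filter, ← hx₀]
      exact ⟨mem_univ _, hrep x₀⟩
    have hfb : f (rep v) = v := by simpa [hB] using hb
    have hSB : Disjoint S B := disjoint_left.2 fun x hx hxB => by
      simp only [hS, hB, mem_filter, mem_univ, true_and, mem_insert, not_or] at hx hxB
      exact hx.1.1 hxB
    have hT : (S ∪ B).erase (rep v) = S' := by
      ext x
      simp only [hS, hB, hS', mem_erase, mem_union, mem_filter, mem_univ, true_and, mem_insert,
        not_or]
      constructor
      · rintro ⟨hx, ⟨⟨-, h1⟩, h2⟩ | h⟩
        · exact ⟨h1, h2⟩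
        · exact ⟨h ▸ hv, Or.inr (by rw [h]; exact Ne.symm hx)⟩
      · rintro ⟨h1, h2⟩
        by_cases hx : f x = v
        · refine ⟨?_, Or.inr hx⟩
          rintro rfl
          rw [hfb] at h2
          rcases h2 with h2 | h2
          · exact hvQ.1 h2
          · exact h2 rfl
        · refine ⟨?_, Or.inl ⟨⟨hx, h1⟩, h2⟩⟩
          rintro rfl
          exact hx hfb
    have hcomm : ∀ g ∈ permsOn (S ∪ B), ∀ y ∈ colorPerms f V, g * y = y * g := by
      intro g hg y hy
      rw [mem_colorPerms] at hy
      have hgV : ∀ x, f x ∈ V → g x = x := fun x hx => mem_permsOn.1 hg x (by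
        simp only [hS, hB, mem_union, mem_filter, mem_univ, true_and, mem_insert]
        rintro (h | h)
        · exact h.1 (Or.inr hx)
        · exact hv (h ▸ hx))
      ext x
      rw [Perm.mul_apply, Perm.mul_apply]
      by_cases hx : f x ∈ V
      · rw [hgV x hx, hgV _ (by rwa [hy.1])]
      · rw [hy.2 x hx, hy.2]
        intro h
        exact hx (by rwa [g.injective (hgV _ h)] at h)
    have havg : ∀ Φ : Perm α → ℕ,
        (permsOn (S ∪ B)).card * ∑ c ∈ fullCycles a, ∑ y ∈ colorPerms f V, Φ (y * c) =
          ∑ c ∈ fullCycles a, ∑ y ∈ colorPerms f V,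
            ∑ g ∈ permsOn (S ∪ B), Φ (g * (y * c) * g⁻¹) := by
      intro Φ
      have h1 : ∀ g ∈ permsOn (S ∪ B),
          ∑ c ∈ fullCycles a, ∑ y ∈ colorPerms f V, Φ (g * (y * c) * g⁻¹) =
            ∑ c ∈ fullCycles a, ∑ y ∈ colorPerms f V, Φ (y * c) := by
        intro g hg
        rw [← sum_fullCycles_conj a g fun c => ∑ y ∈ colorPerms f V, Φ (y * c)]
        refine sum_congr rfl fun c _ => sum_congr rfl fun y hy => ?_
        rw [← mul_assoc g y, hcomm g hg y hy]
        simp only [mul_assoc]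
      rw [← smul_eq_mul, ← sum_const, ← sum_congr rfl h1, sum_comm]
      refine sum_congr rfl fun c _ => ?_
      rw [sum_comm]
    have hpos : 0 < (permsOn (S ∪ B)).card := by rw [card_permsOn]; exact Nat.factorial_pos _
    have hWins : ∀ c, ((colorPerms f (insert v V)).filter fun y => Meets (y * c) S).card =
        ∑ y ∈ colorPerms f V, ((permsOn B).filter fun z => Meets (z * (y * c)) S).card := by
      intro c
      simp only [card_filter]
      rw [sum_colorPerms_insert f hv]
      simp only [mul_assoc]
      rfl
    have hstep : S'.card * ∑ c ∈ fullCycles a,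
          ((colorPerms f (insert v V)).filter fun y => Meets (y * c) S).card =
        S.card * B.card.factorial *
          ∑ c ∈ fullCycles a, ((colorPerms f V).filter fun y => Meets (y * c) S').card := by
      apply Nat.eq_of_mul_eq_mul_left hpos
      rw [mul_left_comm, mul_left_comm _ (S.card * B.card.factorial)]
      simp only [hWins]
      rw [havg fun ρ => ((permsOn B).filter fun z => Meets (z * ρ) S).card]
      simp only [card_filter (s := colorPerms f V)]
      rw [havg fun ρ => if Meets ρ S' then 1 else 0]
      simp only [mul_sum (s := fullCycles a), mul_sum (s := colorPerms f V)]
      refine sum_congr rfl fun c _ => sum_congr rfl fun y _ => ?_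
      have := sum_conj_card_meets hSB hb (y * c)
      rw [hT] at this
      rw [this, card_filter (s := permsOn (S ∪ B))]
    have hS'pos : 0 < S'.card := card_pos.2 ⟨a, by
      simp only [hS', mem_filter, mem_univ, true_and]
      exact ⟨fun h => (mem_erase.1 (hV (mem_insert_of_mem h))).1 rfl, by simp⟩⟩
    apply Nat.eq_of_mul_eq_mul_left hS'pos
    rw [mul_left_comm, hstep, mul_left_comm, ih, card_colorPerms_insert f hv]
    ring

/-- Among the permutations `y` preserving a coloring with `p` colors, those making `y * c` cyclic
have average density `1 / (n + 1 - p)` over all cyclic permutations `c`. -/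
lemma card_fullCycles_color (f : α → β) (a : α) :
    (Fintype.card α + 1 - (univ.image f).card) *
      ∑ c ∈ fullCycles a,
        (univ.filter fun y : Perm α => f ∘ y = f ∧ y * c ∈ fullCycles a).card =
    (univ.filter fun y : Perm α => f ∘ y = f).card * (Fintype.card α - 1).factorial := by
  have : Nonempty α := ⟨a⟩
  let rep : β → α := Function.invFun f
  have hrep : ∀ x, f (rep (f x)) = f x := fun x => Function.invFun_eq ⟨x, rfl⟩
  set Q := (univ.image f).erase (f a) with hQ
  set B : Finset α := univ.filter fun x => f x = f a with hB
  have main := card_fullCycles_colorPerms_meets f a rep hrep Q subset_rfl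
  have hrQ : f a ∉ Q := by simp [hQ]
  have haB : a ∈ B := by simp [hB]
  have hSB : (univ.filter fun x => f x ∉ Q ∧ (f x = f a ∨ rep (f x) ≠ x)) = B := by
    ext x
    simp only [hQ, hB, mem_filter, mem_univ, true_and, mem_erase, mem_image, not_and]
    constructor
    · rintro ⟨h1, -⟩
      by_contra h
      exact h1 h ⟨x, rfl⟩
    · exact fun h => ⟨fun h' => absurd h h', Or.inl h⟩
  have hY : (univ.filter fun y : Perm α => f ∘ y = f) = colorPerms f (insert (f a) Q) := by
    ext y
    rw [mem_colorPerms, mem_filter, hQ, insert_erase (mem_image_of_mem f (mem_univ a))]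
    simp [funext_iff]
  have hm : (univ.filter fun x => f x = f a ∨ rep (f x) ≠ x).card =
      Fintype.card α + 1 - (univ.image f).card := by
    have h1 : (univ.filter fun x => ¬ (f x = f a ∨ rep (f x) ≠ x)) = Q.image rep := by
      ext x
      simp only [hQ, mem_filter, mem_univ, true_and, mem_image, mem_erase, not_or, not_not]
      constructor
      · exact fun h => ⟨f x, ⟨h.1, x, rfl⟩, h.2⟩
      · rintro ⟨_, ⟨h1, z, rfl⟩, rfl⟩
        rw [hrep]
        exact ⟨h1, rfl⟩
    have h2 : (Q.image rep).card = Q.card := card_image_of_injOn fun u hu w hw e => by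
      rw [hQ, mem_coe, mem_erase, mem_image] at hu hw
      obtain ⟨-, x, -, rfl⟩ := hu
      obtain ⟨-, z, -, rfl⟩ := hw
      rw [← hrep x, e, hrep z]
    have h3 := card_filter_add_card_filter_not (s := (univ : Finset α))
      (fun x => f x = f a ∨ rep (f x) ≠ x)
    rw [h1, h2, card_univ, hQ, card_erase_of_mem (mem_image_of_mem f (mem_univ a))] at h3
    have h4 : 0 < (univ.image f).card := card_pos.2 ⟨f a, mem_image_of_mem f (mem_univ a)⟩
    lia
  rw [hSB, hm] at main
  have hfin : ∀ c, (univ.filter fun y : Perm α => f ∘ y = f ∧ y * c ∈ fullCycles a).card =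
      (B.card - 1).factorial * ((colorPerms f Q).filter fun y => Meets (y * c) B).card := by
    intro c
    rw [← filter_filter, hY, card_filter, sum_colorPerms_insert f hrQ,
      card_filter (s := colorPerms f Q), mul_sum]
    refine sum_congr rfl fun y _ => ?_
    have := card_permsOn_mul_meets_singleton haB (y * c)
    rw [card_filter] at this
    simp only [mem_fullCycles, mul_assoc]
    rw [mul_ite, mul_one, mul_zero, ← this]
  simp only [hfin]
  rw [← mul_sum, mul_left_comm, main, hY, card_colorPerms_insert f hrQ,
    ← Nat.mul_factorial_pred (card_pos.2 ⟨a, haB⟩).ne']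
  ring

end Meets

section FullCycles

open Equiv Finset
open scoped Classical

open Fin.NatCast Fin.CommRing in
lemma finRotate_mem_fullCycles (m : ℕ) : finRotate (m + 1) ∈ fullCycles (0 : Fin (m + 1)) := by
  rw [mem_fullCycles]
  intro C hC hd
  refine Set.eq_empty_of_forall_notMem fun x hx => hd 0 ?_ (mem_singleton_self 0)
  have : ∀ j : ℕ, x + (j : Fin (m + 1)) ∈ C := fun j => by
    induction j with
    | zero => simpa using hx
    | succ j ih => simpa [add_assoc] using hC _ ih
  simpa using this (-x).val

lemma isConj_finRotate_iff {m : ℕ} {ω : Perm (Fin (m + 1))} :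
    IsConj (finRotate (m + 1)) ω ↔ ω ∈ fullCycles 0 := by
  constructor
  · intro h
    obtain ⟨g, rfl⟩ := isConj_iff.1 h
    exact conj_mem_fullCycles g (finRotate_mem_fullCycles m)
  · intro h
    rw [mem_fullCycles] at h
    rcases m with _ | m
    · rw [Subsingleton.elim (finRotate 1) ω]
    have hne : ∀ x, ω x ≠ x := fun x hx => by
      have := h.singleton x {x}ᶜ (fun y hy hyx => hy (ω.injective (by rw [hyx, hx]))) (by simp)
      obtain ⟨y, hy⟩ := exists_ne x
      exact (this ▸ hy : y ∈ (∅ : Set _))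
    have hcyc : ω.IsCycle := by
      refine ⟨0, hne 0, fun y _ => ?_⟩
      by_contra hy
      have := h {y | ¬ ω.SameCycle 0 y} (fun z hz => by simpa using hz) (fun z hz hz0 => hz (by
        rw [mem_singleton.1 hz0]))
      exact (this ▸ hy : y ∈ (∅ : Set _))
    rw [isCycle_finRotate.isConj_iff hcyc, support_finRotate]
    congr 1
    ext x
    simp [hne x]

end FullCycles

section Colorings

open Equiv Finset

lemma card_invariant_colorings {α : Type*} [Fintype α] [DecidableEq α] (σ : Perm α) (N : ℕ) :
    (univ.filter fun f : α → Fin N => f ∘ σ = f).card = N ^ cycleCount σ := by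
  let Ψ : α → {x // x ∉ σ.support} ⊕ σ.cycleFactorsFinset := fun x =>
    if h : x ∈ σ.support then
      Sum.inr ⟨σ.cycleOf x, Perm.cycleOf_mem_cycleFactorsFinset_iff.2 h⟩
    else Sum.inl ⟨x, h⟩
  have hΨ : Function.Surjective Ψ := by
    rintro (⟨x, hx⟩ | ⟨c, hc⟩)
    · exact ⟨x, dif_neg hx⟩
    · obtain ⟨x, hx⟩ := (Perm.mem_cycleFactorsFinset_iff.1 hc).1.nonempty_support
      refine ⟨x, ?_⟩
      have : x ∈ σ.support := Perm.mem_cycleFactorsFinset_support_le hc hx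
      simp only [Ψ, dif_pos this]
      exact congrArg Sum.inr (Subtype.ext (Perm.cycle_is_cycleOf hx hc).symm)
  have hinv : ∀ x, Ψ (σ x) = Ψ x := fun x => by
    by_cases hx : x ∈ σ.support
    · have hx' : σ x ∈ σ.support := Perm.apply_mem_support.2 hx
      simp only [Ψ, dif_pos hx, dif_pos hx']
      exact congrArg Sum.inr (Subtype.ext (Perm.cycleOf_self_apply σ x))
    · rw [Perm.notMem_support.1 hx]
  have hsame : ∀ x y, Ψ x = Ψ y → σ.SameCycle x y := fun x y h => by
    by_cases hx : x ∈ σ.support <;> by_cases hy : y ∈ σ.support <;>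
      simp only [Ψ, hx, hy, dite_true, dite_false, Sum.inr.injEq, Sum.inl.injEq, Subtype.mk.injEq,
        reduceCtorEq] at h
    · exact (Perm.sameCycle_iff_cycleOf_eq_of_mem_support hx hy).2 h
    · rw [h]
  have hf : ∀ f : α → Fin N, f ∘ σ = f → ∀ x y, Ψ x = Ψ y → f x = f y := fun f hf x y h => by
    obtain ⟨i, -, rfl⟩ := (hsame x y h).exists_pow_eq'
    clear h
    induction i with
    | zero => rfl
    | succ i ih => rw [pow_succ', Perm.mul_apply, ih]; exact (congrFun hf _).symm
  have hcard : Fintype.card ({x // x ∉ σ.support} ⊕ σ.cycleFactorsFinset) = cycleCount σ := by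
    rw [Fintype.card_sum, Fintype.card_coe, Fintype.card_subtype_compl, Fintype.card_coe,
      cycleCount, Perm.sum_cycleType, Perm.cycleType_def, Multiset.card_map]
    rfl
  rw [← hcard, ← Fintype.card_fin N, ← Fintype.card_fun, Fintype.card_fin, ← card_univ]
  symm
  refine card_nbij (fun g => g ∘ Ψ) (fun g _ => ?_) (fun g _ g' _ h => ?_) (fun f h => ?_)
  · rw [mem_coe, mem_filter]
    exact ⟨mem_univ _, funext fun x => congrArg g (hinv x)⟩
  · exact hΨ.injective_comp_right h
  · have := hf f (by simpa using h)
    obtain ⟨s, hs⟩ := hΨ.hasRightInverse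
    exact ⟨f ∘ s, by simp, funext fun x => this _ _ (hs _)⟩

lemma card_colorPerms {α β : Type*} [Fintype α] [DecidableEq α] [DecidableEq β] (f : α → β)
    (V : Finset β) :
    (colorPerms f V).card = ∏ v ∈ V, (univ.filter fun x => f x = v).card.factorial := by
  classical
  induction V using Finset.induction_on with
  | empty => rw [colorPerms_empty, card_singleton, prod_empty]
  | insert v V hv ih =>
    rw [prod_insert hv, ← ih]
    convert card_colorPerms_insert f hv

lemma card_color_preserving {α β : Type*} [Fintype α] [DecidableEq α] [Fintype β] [DecidableEq β]
    (f : α → β) :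
    (univ.filter fun y : Perm α => f ∘ y = f).card =
      ∏ v, (univ.filter fun x => f x = v).card.factorial := by
  rw [← card_colorPerms]
  congr 1
  ext y
  simp [mem_colorPerms, funext_iff]

lemma card_fiber_cons {n : ℕ} {β : Type*} [DecidableEq β] (x v : β) (g : Fin n → β) :
    (univ.filter fun i => (Fin.cons x g : Fin (n + 1) → β) i = v).card =
      (univ.filter fun i => g i = v).card + if x = v then 1 else 0 := by
  rw [card_filter, card_filter, Fin.sum_univ_succ, add_comm]
  simp

/-- The sum over colorings of `Fin n` by `Fin N`, each weighted by its number of symmetries times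
a function `w` of the number of colors used. -/
noncomputable def coloringSum (n N : ℕ) (w : ℕ → ℚ) : ℚ :=
  ∑ f : Fin n → Fin N, ((univ.filter fun y : Perm (Fin n) => f ∘ y = f).card : ℚ) *
    w (univ.image f).card

lemma coloringSum_zero (N : ℕ) (w : ℕ → ℚ) : coloringSum 0 N w = w 0 := by
  have : ∀ f : Fin 0 → Fin N, (univ.filter fun y : Perm (Fin 0) => f ∘ y = f) = univ := fun f =>
    filter_true_of_mem fun y _ => Subsingleton.elim _ _
  simp only [coloringSum, this]
  simp

lemma coloringSum_succ (n N : ℕ) (w : ℕ → ℚ) :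
    coloringSum (n + 1) N w =
      coloringSum n N fun p => (n + p) * w p + (N - p) * w (p + 1) := by
  rw [coloringSum, coloringSum, ← (Fin.consEquiv fun _ => Fin N).sum_comp, Fintype.sum_prod_type,
    sum_comm]
  refine sum_congr rfl fun g _ => ?_
  have hterm : ∀ x : Fin N, ((univ.filter fun y : Perm (Fin (n + 1)) =>
      (Fin.cons x g : Fin (n + 1) → Fin N) ∘ y = Fin.cons x g).card : ℚ) =
      (univ.filter fun y : Perm (Fin n) => g ∘ y = g).card *
        ((univ.filter fun i => g i = x).card + 1) := fun x => by
    rw [card_color_preserving, card_color_preserving, ← mul_prod_erase univ _ (mem_univ x),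
      ← mul_prod_erase (univ : Finset (Fin N))
        (fun v => (univ.filter fun i => g i = v).card.factorial) (mem_univ x)]
    have : ∏ v ∈ univ.erase x, (univ.filter fun i =>
        (Fin.cons x g : Fin (n + 1) → Fin N) i = v).card.factorial =
        ∏ v ∈ univ.erase x, (univ.filter fun i => g i = v).card.factorial :=
      prod_congr rfl fun v hv => by
        rw [card_fiber_cons, if_neg (ne_of_mem_erase hv).symm, add_zero]
    rw [this, card_fiber_cons, if_pos rfl, Nat.factorial_succ]
    push_cast
    ring
  have himg : ∀ x : Fin N, univ.image (Fin.cons x g : Fin (n + 1) → Fin N) =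
      insert x (univ.image g) := fun x => by
    ext v
    simp [Fin.exists_fin_succ, eq_comm]
  have hw : ∀ x : Fin N, (((univ.filter fun i => g i = x).card : ℚ) + 1) *
      w (insert x (univ.image g)).card =
      if x ∈ univ.image g then ((univ.filter fun i => g i = x).card + 1) * w (univ.image g).card
      else w ((univ.image g).card + 1) := fun x => by
    split_ifs with h
    · rw [insert_eq_of_mem h]
    · rw [card_insert_of_notMem h, filter_false_of_mem fun i _ hi =>
        h (mem_image.2 ⟨i, mem_univ i, hi⟩)]
      simp
  have hfib : ∑ x ∈ univ.image g, ((univ.filter fun i => g i = x).card : ℚ) = n := by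
    rw [← Nat.cast_sum, ← card_eq_sum_card_image, card_univ, Fintype.card_fin]
  change ∑ x, (((univ.filter fun y : Perm (Fin (n + 1)) =>
      (Fin.cons x g : Fin (n + 1) → Fin N) ∘ y = Fin.cons x g).card : ℕ) : ℚ) *
    w (univ.image (Fin.cons x g : Fin (n + 1) → Fin N)).card = _
  simp only [hterm, himg, mul_assoc, hw]
  rw [← mul_sum, sum_ite, filter_mem_eq_inter, univ_inter, ← sum_mul, sum_add_distrib, hfib,
    sum_const, sum_const, filter_not, filter_mem_eq_inter, univ_inter, card_sdiff_of_subset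
      (subset_univ _), nsmul_eq_mul, nsmul_eq_mul,
      Nat.cast_sub (card_le_card (subset_univ _)), card_univ, Fintype.card_fin, mul_one]

lemma coloringSum_one (n N : ℕ) :
    coloringSum n N (fun _ => 1) = (ascPochhammer ℚ n).eval (N : ℚ) := by
  have hlin : ∀ (n : ℕ) (c : ℚ), coloringSum n N (fun _ => c) = c * coloringSum n N fun _ => 1 :=
    fun n c => by simp [coloringSum, mul_sum, mul_comm]
  induction n with
  | zero => simp [coloringSum_zero]
  | succ n ih =>
    rw [coloringSum_succ]
    have : (fun p : ℕ => ((n : ℚ) + p) * 1 + ((N : ℚ) - p) * 1) = fun _ => (N + n : ℚ) := by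
      ext; ring
    rw [this, hlin, ih, ascPochhammer_succ_right]
    simp [mul_comm]

lemma coloringSum_eq (m N : ℕ) (w : ℕ → ℚ) :
    coloringSum (m + 1) N w =
      (m + 1).factorial * ∑ q ∈ range (m + 1), N.choose (q + 1) * m.choose q * w (q + 1) := by
  induction m generalizing w with
  | zero =>
    rw [coloringSum_succ, coloringSum_zero]
    simp
  | succ m ih =>
    rw [coloringSum_succ, ih, Nat.factorial_succ (m + 1), Nat.cast_mul,
      mul_comm ((m + 1 + 1 : ℕ) : ℚ), mul_assoc]
    congr 1
    have hN : ∀ q : ℕ, ((N : ℚ) - (q + 1 : ℕ)) * N.choose (q + 1) =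
        (q + 2) * N.choose (q + 2) := fun q => by
      have h := Nat.choose_succ_right_eq N (q + 1)
      rcases le_or_gt (q + 1) N with hq | hq
      · have h := congrArg (Nat.cast (R := ℚ)) h
        rw [Nat.cast_mul, Nat.cast_mul, Nat.cast_sub hq] at h
        push_cast at h ⊢
        linarith
      · rw [Nat.choose_eq_zero_of_lt hq, Nat.choose_eq_zero_of_lt (Nat.lt_succ_of_lt hq)]
        simp
    have hm : ∀ q : ℕ, (m.choose (q + 1) : ℚ) * (q + 1) = m.choose q * (m - q) := fun q => by
      have h := Nat.choose_succ_right_eq m q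
      rcases le_or_gt q m with hq | hq
      · have h := congrArg (Nat.cast (R := ℚ)) h
        rwa [Nat.cast_mul, Nat.cast_mul, Nat.cast_sub hq, Nat.cast_succ] at h
      · rw [Nat.choose_eq_zero_of_lt hq, Nat.choose_eq_zero_of_lt (Nat.lt_succ_of_lt hq)]
        simp
    calc
      _ = ∑ q ∈ range (m + 1), (m + q + 2 : ℚ) * m.choose q * (N.choose (q + 1) * w (q + 1)) +
          ∑ q ∈ range (m + 1), (q + 2 : ℚ) * m.choose q * (N.choose (q + 2) * w (q + 2)) := by
        rw [← sum_add_distrib]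
        refine sum_congr rfl fun q _ => ?_
        push_cast at hN ⊢
        linear_combination (m.choose q * w (q + 2) : ℚ) * hN q
      _ = ∑ q ∈ range (m + 2), (m + q + 2 : ℚ) * m.choose q * (N.choose (q + 1) * w (q + 1)) +
          ∑ q ∈ range (m + 1), (q + 2 : ℚ) * m.choose q * (N.choose (q + 2) * w (q + 2)) := by
        rw [sum_range_succ _ (m + 1), Nat.choose_succ_self]
        simp
      _ = _ := by
        rw [sum_range_succ', sum_range_succ' _ (m + 1), add_right_comm, ← sum_add_distrib, mul_add,
          mul_sum]
        congr 1
        · refine sum_congr rfl fun q _ => ?_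
          rw [Nat.choose_succ_succ m q]
          push_cast
          linear_combination (N.choose (q + 2) * w (q + 2) : ℚ) * hm q
        · push_cast
          simp only [Nat.choose_zero_right]
          ring

end Colorings

section Genus

open Equiv Finset Polynomial
open scoped Classical

lemma sum_perm_pow_cycleCount (n N : ℕ) :
    ∑ σ : Perm (Fin n), (N : ℚ) ^ cycleCount σ = (ascPochhammer ℚ n).eval (N : ℚ) := by
  rw [← coloringSum_one, coloringSum]
  simp only [← Nat.cast_pow, ← card_invariant_colorings, card_filter, mul_one]
  rw [← Nat.cast_sum, ← Nat.cast_sum, sum_comm]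

lemma cycleCount_conj {α : Type*} [Fintype α] [DecidableEq α] (g σ : Perm α) :
    cycleCount (g * σ * g⁻¹) = cycleCount σ := by
  rw [cycleCount, Perm.cycleType_conj, cycleCount]

lemma sum_fullCycles_pow_eq_sum_colorings (m N : ℕ) :
    m.factorial * ∑ ω ∈ fullCycles (0 : Fin (m + 1)), N ^ cycleCount (ω * finRotate (m + 1)) =
      ∑ f : Fin (m + 1) → Fin N, ∑ c ∈ fullCycles 0,
        (univ.filter fun y : Perm (Fin (m + 1)) => f ∘ y = f ∧ y * c ∈ fullCycles 0).card := by
  have hconst : ∀ c ∈ fullCycles (0 : Fin (m + 1)),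
      ∑ ω ∈ fullCycles (0 : Fin (m + 1)), N ^ cycleCount (ω * c) =
        ∑ ω ∈ fullCycles (0 : Fin (m + 1)), N ^ cycleCount (ω * finRotate (m + 1)) :=
    fun c hc => by
    obtain ⟨g, rfl⟩ := isConj_iff.1 (isConj_finRotate_iff.2 hc)
    rw [← sum_fullCycles_conj 0 g]
    refine sum_congr rfl fun ω _ => ?_
    rw [← cycleCount_conj g (ω * _)]
    congr 2
    group
  have hmoves : ∀ f : Fin (m + 1) → Fin N,
      ∑ c ∈ fullCycles (0 : Fin (m + 1)), (univ.filter fun y : Perm (Fin (m + 1)) =>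
        f ∘ y = f ∧ y * c ∈ fullCycles 0).card =
      ∑ c ∈ fullCycles (0 : Fin (m + 1)), ((fullCycles 0).filter fun ω : Perm (Fin (m + 1)) =>
        f ∘ (ω * c : Perm (Fin (m + 1))) = f).card := fun f => by
    refine sum_nbij' (fun c => c⁻¹) (fun c => c⁻¹) ?_ ?_ ?_ ?_ ?_
    · exact fun c hc => mem_fullCycles.2 (mem_fullCycles.1 hc).inv
    · exact fun c hc => mem_fullCycles.2 (mem_fullCycles.1 hc).inv
    · exact fun c _ => inv_inv c
    · exact fun c _ => inv_inv c
    · intro c _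
      refine card_nbij' (fun y => y * c) (fun ω => ω * c⁻¹) ?_ ?_ ?_ ?_
      · intro y hy
        rw [mem_coe, mem_filter] at *
        exact ⟨hy.2.2, by rw [mul_inv_cancel_right]; exact hy.2.1⟩
      · intro ω hω
        rw [mem_coe, mem_filter] at *
        exact ⟨mem_univ _, hω.2, by rw [inv_mul_cancel_right]; exact hω.1⟩
      · intro y _; simp
      · intro ω _; simp
  have hF : (fullCycles (0 : Fin (m + 1))).card = m.factorial := by
    rw [card_fullCycles, Fintype.card_fin, Nat.add_sub_cancel]
  rw [sum_congr rfl fun f _ => hmoves f, ← hF, ← smul_eq_mul, ← sum_const, ← sum_congr rfl hconst]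
  conv_rhs => rw [sum_comm]
  refine sum_congr rfl fun c _ => ?_
  have hl : ∀ ω : Perm (Fin (m + 1)), N ^ cycleCount (ω * c) =
      ∑ f : Fin (m + 1) → Fin N, if f ∘ (ω * c : Perm (Fin (m + 1))) = f then 1 else 0 :=
    fun ω => by
      rw [← card_invariant_colorings, card_filter]
  rw [sum_congr rfl fun ω _ => hl ω, sum_comm]
  exact sum_congr rfl fun f _ => by rw [card_filter]

lemma sum_fullCycles_pow_eq_coloringSum (m N : ℕ) :
    ∑ ω ∈ fullCycles (0 : Fin (m + 1)), (N : ℚ) ^ cycleCount (ω * finRotate (m + 1)) =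
      coloringSum (m + 1) N fun p => 1 / (m + 2 - p) := by
  have hm : (m.factorial : ℚ) ≠ 0 := Nat.cast_ne_zero.2 (Nat.factorial_ne_zero m)
  have hcount := congrArg (Nat.cast (R := ℚ)) (sum_fullCycles_pow_eq_sum_colorings m N)
  rw [Nat.cast_mul, Nat.cast_sum, Nat.cast_sum] at hcount
  simp only [Nat.cast_pow] at hcount
  apply mul_left_cancel₀ hm
  rw [hcount, coloringSum, mul_sum]
  refine sum_congr rfl fun f _ => ?_
  have hle : (univ.image f).card ≤ m + 1 := card_image_le.trans (by simp)
  have h := congrArg (Nat.cast (R := ℚ)) (card_fullCycles_color f 0)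
  rw [Fintype.card_fin, Nat.add_sub_cancel, Nat.cast_mul, Nat.cast_mul,
    Nat.cast_sub (hle.trans (Nat.le_add_right _ 1)), Nat.cast_add, Nat.cast_add, Nat.cast_one,
    add_assoc, one_add_one_eq_two] at h
  have hne : (m + 2 - (univ.image f).card : ℚ) ≠ 0 := by
    have : ((univ.image f).card : ℚ) ≤ m + 1 := by exact_mod_cast hle
    linarith
  rw [mul_one_div, mul_div_assoc', eq_div_iff hne, mul_comm (m.factorial : ℚ)]
  convert h using 1
  · rw [mul_comm]
    congr!
  · congr!

lemma sum_fullCycles_pow (m N : ℕ) :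
    ((m + 1) * (m + 2) : ℚ) *
        ∑ ω ∈ fullCycles (0 : Fin (m + 1)), (N : ℚ) ^ cycleCount (ω * finRotate (m + 1)) =
      (ascPochhammer ℚ (m + 2)).eval (N : ℚ) - (descPochhammer ℚ (m + 2)).eval (N : ℚ) := by
  have hasc : (ascPochhammer ℚ (m + 2)).eval (N : ℚ) =
      (m + 2).factorial * (N + (m + 1)).choose (m + 2) := by
    rw [ascPochhammer_nat_eq_natCast_descFactorial, Nat.descFactorial_eq_factorial_mul_choose,
      Nat.cast_mul]
    rfl
  have hdesc : (descPochhammer ℚ (m + 2)).eval (N : ℚ) = (m + 2).factorial * N.choose (m + 2) := by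
    rw [descPochhammer_eval_eq_descFactorial, Nat.descFactorial_eq_factorial_mul_choose,
      Nat.cast_mul]
  have hvan : (N + (m + 1)).choose (m + 2) =
      ∑ q ∈ range (m + 1), N.choose (q + 1) * (m + 1).choose q + N.choose (m + 2) := by
    rw [Nat.add_choose_eq, Nat.sum_antidiagonal_eq_sum_range_succ
      fun i j => N.choose i * (m + 1).choose j, sum_range_succ', Nat.sub_zero, Nat.choose_succ_self,
      mul_zero, add_zero, sum_range_succ, Nat.sub_self, Nat.choose_zero_right, mul_one]
    congr 1
    refine sum_congr rfl fun q hq => ?_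
    rw [Nat.add_sub_add_right (m + 1) 1,
      Nat.choose_symm ((mem_range_succ_iff.1 hq).trans (Nat.le_succ m))]
  have hq : ∀ q ∈ range (m + 1),
      (N.choose (q + 1) * m.choose q * (1 / (m + 2 - (q + 1 : ℕ))) : ℚ) =
        N.choose (q + 1) * (m + 1).choose q / (m + 1) := fun q hq => by
    have hq : q ≤ m := mem_range_succ_iff.1 hq
    have h := congrArg (Nat.cast (R := ℚ)) (Nat.choose_mul_succ_eq m q)
    rw [Nat.cast_mul, Nat.cast_mul, Nat.cast_sub (hq.trans (Nat.le_succ m))] at h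
    push_cast at h ⊢
    have h1 : (m + 2 - (q + 1) : ℚ) ≠ 0 := by
      have : (q : ℚ) ≤ m := by exact_mod_cast hq
      linarith
    have h2 : (m + 1 : ℚ) ≠ 0 := by positivity
    rw [mul_one_div, div_eq_div_iff h1 h2]
    linear_combination (N.choose (q + 1) : ℚ) * h
  rw [sum_fullCycles_pow_eq_coloringSum, coloringSum_eq, sum_congr rfl hq, ← sum_div, hasc, hdesc,
    hvan, Nat.factorial_succ (m + 1)]
  push_cast
  have : (m + 1 : ℚ) ≠ 0 := by positivity
  field_simp
  ring

/-- The generating polynomial of the numbers `xi (m + 1) k`. -/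
noncomputable def xiPoly (m : ℕ) : ℚ[X] :=
  ∑ ω ∈ fullCycles (0 : Fin (m + 1)), X ^ cycleCount (ω * finRotate (m + 1))

lemma coeff_xiPoly (m k : ℕ) : (xiPoly m).coeff k = xi (m + 1) k := by
  have h : {ω : Perm (Fin (m + 1)) |
      IsConj (finRotate (m + 1)) ω ∧ cycleCount (ω * finRotate (m + 1)) = k} =
      ((fullCycles 0).filter fun ω : Perm (Fin (m + 1)) =>
        cycleCount (ω * finRotate (m + 1)) = k : Finset (Perm (Fin (m + 1)))) := by
    ext ω
    rw [mem_coe, mem_filter, ← isConj_finRotate_iff]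
    rfl
  rw [xi, h, Set.ncard_coe_finset, xiPoly, finsetSum_coeff, card_filter, Nat.cast_sum]
  refine sum_congr rfl fun ω _ => ?_
  rw [coeff_X_pow]
  simp [eq_comm]

lemma eq_of_eval_natCast_eq {p q : ℚ[X]} (h : ∀ N : ℕ, p.eval (N : ℚ) = q.eval (N : ℚ)) : p = q :=
  eq_of_infinite_eval_eq p q (Set.infinite_of_injective_forall_mem Nat.cast_injective h)

lemma coeff_ascPochhammer (n k : ℕ) : (ascPochhammer ℚ n).coeff k = stirling1 n k := by
  have : ascPochhammer ℚ n = ∑ σ : Perm (Fin n), X ^ cycleCount σ :=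
    eq_of_eval_natCast_eq fun N => by
      rw [← sum_perm_pow_cycleCount, eval_finsetSum]
      simp
  rw [this, stirling1, finsetSum_coeff, card_filter, Nat.cast_sum]
  refine sum_congr rfl fun σ _ => ?_
  rw [coeff_X_pow]
  simp [eq_comm]

lemma mul_xiPoly (m : ℕ) :
    C ((m + 1) * (m + 2) : ℚ) * xiPoly m = ascPochhammer ℚ (m + 2) - descPochhammer ℚ (m + 2) :=
  eq_of_eval_natCast_eq fun N => by
    rw [eval_mul, eval_C, eval_sub, ← sum_fullCycles_pow, xiPoly, eval_finsetSum]
    simp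

lemma descPochhammer_eval_neg (n : ℕ) (x : ℚ) :
    (descPochhammer ℚ n).eval (-x) = (-1) ^ n * (ascPochhammer ℚ n).eval x := by
  rw [← neg_neg x, ascPochhammer_eval_neg_eq_descPochhammer, neg_neg, ← mul_assoc, ← mul_pow]
  simp

lemma mul_eval_xiPoly (m : ℕ) (x : ℚ) :
    (m + 1) * (m + 2) * (xiPoly m).eval x =
      (ascPochhammer ℚ (m + 2)).eval x - (descPochhammer ℚ (m + 2)).eval x := by
  rw [← eval_sub, ← mul_xiPoly, eval_mul, eval_C]

lemma coeff_eq_zero_of_eval_neg {p : ℚ[X]} {n k : ℕ}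
    (hp : ∀ x, p.eval (-x) = (-1) ^ n * p.eval x) (h : Odd (n + k)) : p.coeff k = 0 := by
  have hc : p.comp (C (-1) * X) = C ((-1) ^ n) * p := Polynomial.funext fun x => by
    simp [hp]
  have := congrArg (fun q => q.coeff k) hc
  simp only [comp_C_mul_X_coeff, coeff_C_mul] at this
  have h1 : (-1 : ℚ) ^ n * (-1) ^ k = -1 := by rw [← pow_add, h.neg_one_pow]
  have h2 : (-1 : ℚ) ^ n * (-1) ^ n = 1 := by rw [← mul_pow]; simp
  linear_combination p.coeff k / 2 * h1 - (-1) ^ n / 2 * this - p.coeff k / 2 * h2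

lemma xi_eq_zero_of_odd {m k : ℕ} (h : Odd (m + 1 + k)) : xi (m + 1) k = 0 := by
  rw [← Nat.cast_eq_zero (R := ℚ), ← coeff_xiPoly]
  refine coeff_eq_zero_of_eval_neg (fun x => ?_) h
  have hm : ((m + 1) * (m + 2) : ℚ) ≠ 0 := by positivity
  apply mul_left_cancel₀ hm
  rw [mul_eval_xiPoly, mul_left_comm, mul_eval_xiPoly, ascPochhammer_eval_neg_eq_descPochhammer,
    descPochhammer_eval_neg]
  ring

lemma natDegree_xiPoly_le (m : ℕ) : (xiPoly m).natDegree ≤ m + 2 := by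
  rw [← natDegree_C_mul (by positivity : ((m + 1) * (m + 2) : ℚ) ≠ 0), mul_xiPoly]
  exact (natDegree_sub_le _ _).trans
    (by rw [ascPochhammer_natDegree, descPochhammer_natDegree, max_self])

lemma coeff_xiPoly_relation {m k : ℕ} (h : Even (m + 1 + k)) :
    (C (m + 2 : ℚ) * xiPoly m - X * (xiPoly m).comp (X + 1) - ascPochhammer ℚ (m + 1)).coeff k =
      0 := by
  refine coeff_eq_zero_of_eval_neg (n := m + 2) ?_ (by convert h.add_one using 1; ring)
  have hm : ((m + 1) * (m + 2) : ℚ) ≠ 0 := by positivity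
  have key : ∀ x, (m + 1) * (m + 2) * (C (m + 2 : ℚ) * xiPoly m - X * (xiPoly m).comp (X + 1) -
      ascPochhammer ℚ (m + 1)).eval x =
      -(ascPochhammer ℚ (m + 1)).eval x * (x ^ 2 + (m + 1) * x + (m + 1) * (m + 2)) +
        (descPochhammer ℚ (m + 1)).eval x * (x ^ 2 - (m + 1) * x + (m + 1) * (m + 2)) := fun x => by
    have h1 := mul_eval_xiPoly m x
    have h2 := mul_eval_xiPoly m (x + 1)
    have h3 : x * (ascPochhammer ℚ (m + 2)).eval (x + 1) =
        (ascPochhammer ℚ (m + 1)).eval x * (x + (m + 1)) * (x + (m + 2)) := by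
      have := congrArg (eval x) (ascPochhammer_succ_left ℚ (m + 2))
      rw [ascPochhammer_succ_eval, ascPochhammer_succ_eval] at this
      simp only [eval_mul, eval_X, eval_comp, eval_add, eval_one] at this
      rw [← this]
      push_cast
      ring
    have h4 : (descPochhammer ℚ (m + 2)).eval (x + 1) =
        (x + 1) * (descPochhammer ℚ (m + 1)).eval x := by
      rw [descPochhammer_succ_left]
      simp
    rw [ascPochhammer_succ_eval, descPochhammer_succ_eval] at h1
    simp only [eval_sub, eval_mul, eval_C, eval_X, eval_comp, eval_add, eval_one]
    push_cast at h1
    linear_combination (m + 2 : ℚ) * h1 - x * h2 - h3 + x * h4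
  intro x
  apply mul_left_cancel₀ hm
  rw [key, mul_left_comm, key, ascPochhammer_eval_neg_eq_descPochhammer, descPochhammer_eval_neg]
  ring

lemma sum_range_of_odd_eq_zero {M : Type*} [AddCommMonoid M] {b : ℕ → M}
    (hb : ∀ i, b (2 * i + 1) = 0) (n : ℕ) :
    ∑ t ∈ range (2 * n + 1), b t = b 0 + ∑ i ∈ Icc 1 n, b (2 * i) := by
  induction n with
  | zero => simp
  | succ n ih =>
    rw [sum_Icc_succ_top (by lia), ← add_assoc, ← ih, mul_add, mul_one, sum_range_succ,
      sum_range_succ, hb, add_zero]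

end Genus

/-- For `n, k ≥ 1` with `n - k` even,
`(n + 1 - k)·ξ_{1,k}(n) = ∑_{i ≥ 1} C(k+2i, k-1)·ξ_{1,k+2i}(n) + C(n, k)`.
The sum is finite; all terms with `i > n` vanish, so it is taken over
`1 ≤ i ≤ n`. -/
theorem xi_recurrence (n k : ℕ) (hn : 1 ≤ n) (hk : 1 ≤ k)
    (h : Even (n + k)) :
    (n + 1 - k) * xi n k =
      (∑ i ∈ Finset.Icc 1 n,
        Nat.choose (k + 2 * i) (k - 1) * xi n (k + 2 * i)) +
      stirling1 n k := by
  obtain ⟨m, rfl⟩ := Nat.exists_eq_add_of_le' hn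
  obtain ⟨k, rfl⟩ := Nat.exists_eq_add_of_le' hk
  rw [Nat.add_sub_cancel]
  have hrel := coeff_xiPoly_relation h
  rw [Polynomial.coeff_sub, Polynomial.coeff_sub, Polynomial.coeff_C_mul,
    Polynomial.coeff_X_mul, coeff_xiPoly, coeff_ascPochhammer] at hrel
  have hparity : ∀ j, Odd (m + 1 + j) → j.choose k * xi (m + 1) j = 0 := fun j hj => by
    rw [xi_eq_zero_of_odd hj, mul_zero]
  have hcomp : ((xiPoly m).comp (Polynomial.X + 1)).coeff k =
      ((∑ j ∈ Finset.range (k + 1 + (2 * (m + 1) + 1)), j.choose k * xi (m + 1) j : ℕ) : ℚ) := by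
    rw [(xiPoly m).as_sum_range' (k + 1 + (2 * (m + 1) + 1))
      ((natDegree_xiPoly_le m).trans_lt (by lia)), Polynomial.sum_comp,
      Polynomial.finsetSum_coeff, Nat.cast_sum]
    refine Finset.sum_congr rfl fun j _ => ?_
    rw [Polynomial.monomial_comp, Polynomial.coeff_C_mul,
      Polynomial.coeff_X_add_one_pow, coeff_xiPoly, Nat.cast_mul, mul_comm]
  have hsum : ∑ j ∈ Finset.range (k + 1 + (2 * (m + 1) + 1)), j.choose k * xi (m + 1) j =
      (k + 1) * xi (m + 1) (k + 1) + ∑ i ∈ Finset.Icc 1 (m + 1),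
        (k + 1 + 2 * i).choose k * xi (m + 1) (k + 1 + 2 * i) := by
    rw [Finset.sum_range_add, sum_range_of_odd_eq_zero
      (fun i => hparity _ (by rw [← add_assoc]; exact h.add_odd (odd_two_mul_add_one i))),
      Finset.sum_range_succ,
      hparity k (Nat.not_even_iff_odd.1 (Nat.even_add_one.1 (by rwa [← add_assoc] at h))),
      Finset.sum_eq_zero fun j hj => by
        rw [Nat.choose_eq_zero_of_lt (Finset.mem_range.1 hj), zero_mul]]
    simp
  have hlt : ((m + 1 + 1 - (k + 1) : ℕ) : ℚ) * xi (m + 1) (k + 1) =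
      (m + 1 - k) * xi (m + 1) (k + 1) := by
    rcases le_or_gt k (m + 1) with hkm | hkm
    · rw [Nat.add_sub_add_right, Nat.cast_sub hkm, Nat.cast_add, Nat.cast_one]
    · rw [← coeff_xiPoly, Polynomial.coeff_eq_zero_of_natDegree_lt
        ((natDegree_xiPoly_le m).trans_lt (by lia)), mul_zero, mul_zero]
  rw [hcomp, hsum] at hrel
  apply Nat.cast_injective (R := ℚ)
  rw [Nat.cast_mul, hlt]
  push_cast at hrel ⊢
  linear_combination hrel
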